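/- Fix t_f > 0, vectors r_0, r_f, v_{g0}, v_{gf}, w_0, k in ℝ³, wind w(t) = w_0 + kt, and let u* be the optimal rendez-vous control u*(t) = (2/t_f³)[(r_0 − r_f)(6t − 3t_f) + v_{g0} t_f(3t − 2t_f) + v_{gf} t_f(3t − t_f)] − k, with trajectory v_g(t) = v_{g0} + ∫₀^t (u*(τ) + k)dτ, r(t) = r_0 + ∫₀^t v_g(τ)dτ. For t ∈ [0, t_f), set t_go = t_f − t, ZEM(t) = r_f − [r(t) + v_g(t) t_go + (k/2) t_go²], and ZEV(t) = v_{gf} − [v_g(t) + k t_go]. Then along the optimal trajectory the open-loop control coincides with the ZEM/ZEV feedback law: u*(t) = (6/t_go²) ZEM(t) − (2/t_go) ZEV(t) for every t ∈ [0, t_f). -/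

import Mathlib

/-- The integral over `[0, t]` of a vector-valued polynomial of degree at most two. -/
theorem integral_quadratic_smul {E : Type*} [NormedAddCommGroup E] [NormedSpace ℝ E]
    [CompleteSpace E] (a b c : E) (t : ℝ) :
    ∫ τ in (0:ℝ)..t, (a + τ • b + (τ ^ 2 / 2) • c) =
      t • a + (t ^ 2 / 2) • b + (t ^ 3 / 6) • c := by
  have ha : IntervalIntegrable (fun _ : ℝ => a) MeasureTheory.volume 0 t :=
    Continuous.intervalIntegrable (by fun_prop) _ _
  have hb : IntervalIntegrable (fun τ : ℝ => τ • b) MeasureTheory.volume 0 t :=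
    Continuous.intervalIntegrable (by fun_prop) _ _
  have hc : IntervalIntegrable (fun τ : ℝ => (τ ^ 2 / 2) • c) MeasureTheory.volume 0 t :=
    Continuous.intervalIntegrable (by fun_prop) _ _
  rw [intervalIntegral.integral_add (ha.add hb) hc, intervalIntegral.integral_add ha hb,
    intervalIntegral.integral_smul_const, intervalIntegral.integral_smul_const,
    intervalIntegral.integral_const, intervalIntegral.integral_div, integral_id, integral_pow]
  congr 2
  · simp
  · simp
  · norm_num
    ring


/-- Along the optimal rendez-vous trajectory under wind `w(t) = w₀ + k t`, the
open-loop optimal control coincides with the ZEM/ZEV feedback law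
`u*(t) = (6/t_go²) ZEM(t) − (2/t_go) ZEV(t)` for all `t ∈ [0, t_f)`. -/
theorem statement_10
    (tf : ℝ) (htf : 0 < tf)
    (r0 rf vg0 vgf w0 k : EuclideanSpace ℝ (Fin 3))
    (w : ℝ → EuclideanSpace ℝ (Fin 3)) (hw : ∀ t, w t = w0 + t • k)
    (ustar : ℝ → EuclideanSpace ℝ (Fin 3))
    (hustar : ∀ t, ustar t =
      (2 / tf ^ 3) • ((6 * t - 3 * tf) • (r0 - rf)
        + (tf * (3 * t - 2 * tf)) • vg0 + (tf * (3 * t - tf)) • vgf) - k)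
    (vg r : ℝ → EuclideanSpace ℝ (Fin 3))
    (hvg : ∀ t, vg t = vg0 + ∫ τ in (0:ℝ)..t, (ustar τ + k))
    (hr : ∀ t, r t = r0 + ∫ τ in (0:ℝ)..t, vg τ)
    (ZEM ZEV : ℝ → EuclideanSpace ℝ (Fin 3))
    (hZEM : ∀ t, ZEM t =
      rf - (r t + (tf - t) • vg t + ((tf - t) ^ 2 / 2) • k))
    (hZEV : ∀ t, ZEV t = vgf - (vg t + (tf - t) • k)) :
    ∀ t ∈ Set.Ico (0:ℝ) tf,
      ustar t = (6 / (tf - t) ^ 2) • ZEM t - (2 / (tf - t)) • ZEV t := by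
  rintro t ⟨-, ht⟩
  have htf0 : tf ≠ 0 := htf.ne'
  have hgo : tf - t ≠ 0 := (sub_pos.2 ht).ne'
  set A : EuclideanSpace ℝ (Fin 3) :=
    (2 / tf ^ 3) • ((-3 * tf) • (r0 - rf) + (-2 * tf ^ 2) • vg0 + (-tf ^ 2) • vgf) with hA
  set B : EuclideanSpace ℝ (Fin 3) :=
    (2 / tf ^ 3) • ((6 : ℝ) • (r0 - rf) + (3 * tf) • vg0 + (3 * tf) • vgf) with hB
  have hacc : ∀ τ, ustar τ + k = A + τ • B + (τ ^ 2 / 2) • (0 : EuclideanSpace ℝ (Fin 3)) := by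
    intro τ
    rw [hustar, hA, hB]
    module
  have hvel : ∀ τ, vg τ = vg0 + τ • A + (τ ^ 2 / 2) • B := by
    intro τ
    simp only [hvg, hacc, integral_quadratic_smul]
    module
  have hpos : r t = r0 + (t • vg0 + (t ^ 2 / 2) • A + (t ^ 3 / 6) • B) := by
    simp only [hr, hvel, integral_quadratic_smul]
  rw [hZEM, hZEV, hpos, hvel, hustar, hA, hB]
  match_scalars <;> field_simp <;> ring
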